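/- Let p be an odd prime and let j be a nonnegative integer. If j = kp+r with integers 0 ≤ k < p and 0 ≤ r < p, then St^{(0,j)}(Q_{2,1}) = Q_{2,0}^{r}·Q_{2,1}·Σ_{i=0}^{k} (−1)^i·C(k+1,i+1)·C(r+i,i)·Q_{2,0}^{(k−i)p}·Q_{2,1}^{i(p+1)}; otherwise (i.e. if j ≥ p²) St^{(0,j)}(Q_{2,1}) = 0. (Binomial coefficients are reduced mod p.) -/

import Mathlib

open MvPolynomial Finset

/-- The total Steenrod-Milnor operation `φ : R → R[t₁,t₂]`,
sending `y_k ↦ y_k + y_k^p t₁ + y_k^{p²} t₂`. Here `R = F_p[y₁,y₂]`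
and `R[t₁,t₂]` is modelled as `MvPolynomial (Fin 2) R`. -/
noncomputable def phi (p : ℕ) :
    MvPolynomial (Fin 2) (ZMod p) →ₐ[ZMod p]
      MvPolynomial (Fin 2) (MvPolynomial (Fin 2) (ZMod p)) :=
  aeval (fun k => C (X k) + C (X k ^ p) * X 0 + C (X k ^ (p ^ 2)) * X 1)

/-- The Steenrod-Milnor operation `St^{(i,j)}` : the coefficient of
`t₁^i t₂^j` in `φ f`. -/
noncomputable def St (p i j : ℕ) (f : MvPolynomial (Fin 2) (ZMod p)) :
    MvPolynomial (Fin 2) (ZMod p) :=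
  coeff (Finsupp.single (0 : Fin 2) i + Finsupp.single (1 : Fin 2) j) (phi p f)

/-- `L₂ = y₁ y₂^p - y₁^p y₂`. -/
noncomputable def L2 (p : ℕ) : MvPolynomial (Fin 2) (ZMod p) :=
  X 0 * X 1 ^ p - X 0 ^ p * X 1

/-- `L_{2,0} = y₁^p y₂^{p²} - y₁^{p²} y₂^p`. -/
noncomputable def L20 (p : ℕ) : MvPolynomial (Fin 2) (ZMod p) :=
  X 0 ^ p * X 1 ^ (p ^ 2) - X 0 ^ (p ^ 2) * X 1 ^ p

/-- `L_{2,1} = y₁ y₂^{p²} - y₁^{p²} y₂`. -/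
noncomputable def L21 (p : ℕ) : MvPolynomial (Fin 2) (ZMod p) :=
  X 0 * X 1 ^ (p ^ 2) - X 0 ^ (p ^ 2) * X 1

/-- The auxiliary sum. -/
noncomputable def TT {R : Type*} [CommRing R] (α b : R) (K r : ℕ) : R :=
  ∑ i ∈ Finset.range K, (-1 : R) ^ i * (K.choose (i + 1) : R) * ((r + i).choose i : R)
    * α ^ (K - 1 - i) * b ^ i

lemma TT_mul {R : Type*} [CommRing R] (α b : R) (K r : ℕ) :
    α * TT α b K r = ∑ i ∈ Finset.range (K + 1), (-1 : R) ^ i * (K.choose (i + 1) : R)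
      * ((r + i).choose i : R) * α ^ (K - i) * b ^ i := by
  rw [Finset.sum_range_succ, TT, Finset.mul_sum, Nat.choose_succ_self]
  simp only [Nat.cast_zero, mul_zero, zero_mul, add_zero]
  refine Finset.sum_congr rfl fun i hi => ?_
  have hi := Finset.mem_range.mp hi
  have : K - i = (K - 1 - i) + 1 := by omega
  rw [this, pow_succ]; ring

lemma TT_A {R : Type*} [CommRing R] (α b : R) (K r : ℕ) :
    TT α b (K + 1) (r + 1) - TT α b (K + 1) r - (α * TT α b K (r + 1) - α * TT α b K r)
      + b * TT α b K (r + 1) = 0 := by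
  rw [TT_mul, TT_mul]
  simp only [TT]
  rw [← Finset.sum_sub_distrib, ← Finset.sum_sub_distrib, ← Finset.sum_sub_distrib,
    Finset.sum_range_succ', Finset.mul_sum, add_right_comm, ← Finset.sum_add_distrib]
  have : ∀ x y : R, x = 0 → y = 0 → x + y = 0 := by intro x y h h'; simp [h, h']
  apply this
  · refine Finset.sum_eq_zero fun i hi => ?_
    have hi := Finset.mem_range.mp hi
    have e1 : K + 1 - 1 - (i + 1) = K - 1 - i := by omega
    have e2 : K - (i + 1) = K - 1 - i := by omega
    have e3 : (K + 1).choose (i + 1 + 1) = K.choose (i + 1) + K.choose (i + 1 + 1) :=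
      Nat.choose_succ_succ _ _
    have e4 : (r + 1 + (i + 1)).choose (i + 1)
        = (r + 1 + i).choose i + (r + (i + 1)).choose (i + 1) := by
      have : r + 1 + (i + 1) = (r + 1 + i) + 1 := by omega
      rw [this, Nat.choose_succ_succ]
      congr 2
      omega
    rw [e1, e2, e3, e4]
    push_cast
    ring
  · simp

lemma TT_B {R : Type*} [CommRing R] (α b : R) (K : ℕ) :
    TT α b (K + 1) 0 - α * TT α b K 0 + b * TT α b K 0 = α ^ K := by
  rw [TT_mul]
  simp only [TT]
  rw [← Finset.sum_sub_distrib,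
    Finset.sum_range_succ', Finset.mul_sum, add_right_comm, ← Finset.sum_add_distrib]
  have : ∀ x y z : R, x = 0 → y = z → x + y = z := by intro x y z h h'; simp [h, h']
  apply this
  · refine Finset.sum_eq_zero fun i hi => ?_
    have hi := Finset.mem_range.mp hi
    have e1 : K + 1 - 1 - (i + 1) = K - 1 - i := by omega
    have e2 : K - (i + 1) = K - 1 - i := by omega
    have e3 : (K + 1).choose (i + 1 + 1) = K.choose (i + 1) + K.choose (i + 1 + 1) :=
      Nat.choose_succ_succ _ _
    rw [e1, e2, e3]
    simp only [zero_add, Nat.choose_self]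
    push_cast
    ring
  · simp
    ring

lemma TT_C {R : Type*} [CommRing R] (p : ℕ) (hp : p.Prime) [CharP R p] (α b : R) (K : ℕ)
    (hK : K < p) : TT α b (K + 1) (p - 1) = (K + 1) * α ^ K := by
  rw [TT, Finset.sum_range_succ']
  have : ∀ x y z : R, x = 0 → y = z → x + y = z := by intro x y z h h'; simp [h, h']
  apply this
  · refine Finset.sum_eq_zero fun i hi => ?_
    have hi := Finset.mem_range.mp hi
    have h : p ∣ (p - 1 + (i + 1)).choose (i + 1) :=
      Nat.Prime.dvd_choose hp (by omega) (by omega) (by omega)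
    rw [(CharP.cast_eq_zero_iff R p _).mpr h]
    simp
  · simp

lemma TT_C' {R : Type*} [CommRing R] (p : ℕ) (hp : p.Prime) [CharP R p] (α b : R) (K : ℕ)
    (hK : K ≤ p) : α * TT α b K (p - 1) = K * α ^ K := by
  rcases K with _ | K
  · simp [TT]
  · rw [TT_C p hp α b K (by omega)]
    push_cast
    ring

lemma rec_solve {R : Type*} [CommRing R] (p : ℕ) (hp : p.Prime) [CharP R p] (a b q : R)
    (F : ℕ → R) (hF0 : ∀ n < p, F n = 0) (hFp : F p = q)
    (hF : ∀ n, n + 1 < p ^ 2 →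
      F (n + p + 1) - a * F (n + p) + (b - a ^ p) * F (n + 1) + a ^ (p + 1) * F n = 0) :
    ∀ K, K ≤ p → ∀ r, r < p → F (K * p + r) = q * (a ^ r * TT (a ^ p) b K r) := by
  have hp1 := hp.two_le
  have hap : a * a ^ (p - 1) = a ^ p := by
    rw [← pow_succ']; congr 1; omega
  intro K
  induction K using Nat.strong_induction_on with
  | _ K ih' =>
  rcases K with _ | K
  · intro _ r hr
    rw [hF0 _ (by omega)]
    simp [TT]
  · intro hK r
    have ih := ih' K (by omega) (by omega)
    have hKp : K * p + p ≤ p ^ 2 := by nlinarith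
    induction r with
    | zero =>
      intro _
      rcases K with _ | K
      · simp [TT, hFp]
      · have h := hF (K * p + (p - 1)) (by rw [add_mul] at hKp; omega)
        have e1 : K * p + (p - 1) + p + 1 = (K + 1 + 1) * p + 0 := by
          rw [add_mul, add_mul]; omega
        have e2 : K * p + (p - 1) + p = (K + 1) * p + (p - 1) := by
          rw [add_mul]; omega
        have e3 : K * p + (p - 1) + 1 = (K + 1) * p + 0 := by
          rw [add_mul]; omega
        rw [e1, e2, e3, ih _ (by omega), ih _ (by omega),
          ih' K (by omega) (by omega) _ (by omega)] at h
        have hB := TT_B (a ^ p) b (K + 1)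
        have hC1 := TT_C' p hp (a ^ p) b K (by omega)
        have hC2 := TT_C p hp (a ^ p) b K (by omega)
        rw [hC2] at h
        rw [pow_succ a p] at h
        rw [pow_zero, one_mul] at h ⊢
        linear_combination h - q * hB + q * ((K + 1) * (a ^ p) ^ K) * hap
          - q * (a ^ p * TT (a ^ p) b K (p - 1)) * hap - q * a ^ p * hC1
    | succ r ihr =>
      intro hr
      have ihr := ihr (by omega)
      have h := hF (K * p + r) (by omega)
      have e1 : K * p + r + p + 1 = (K + 1) * p + (r + 1) := by ring
      have e2 : K * p + r + p = (K + 1) * p + r := by ring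
      rw [e1, e2, ihr, ih r (by omega), add_assoc (K * p) r 1, ih (r + 1) hr] at h
      have hA := TT_A (a ^ p) b K r
      linear_combination h - q * a ^ (r + 1) * hA

section

/-- The one-variable version of `phi`, with `t₁ = 0`. -/
noncomputable def psi (p : ℕ) :
    MvPolynomial (Fin 2) (ZMod p) →ₐ[ZMod p] Polynomial (MvPolynomial (Fin 2) (ZMod p)) :=
  MvPolynomial.aeval (fun k => Polynomial.C (MvPolynomial.X k)
    + Polynomial.C (MvPolynomial.X k ^ (p ^ 2)) * Polynomial.X)

lemma coeff_restrict {S : Type*} [CommRing S] (j : ℕ) (f : MvPolynomial (Fin 2) S) :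
    (MvPolynomial.aeval (![0, Polynomial.X] : Fin 2 → Polynomial S) f).coeff j
      = MvPolynomial.coeff (Finsupp.single (0 : Fin 2) 0 + Finsupp.single (1 : Fin 2) j) f := by
  induction f using MvPolynomial.induction_on' with
  | monomial m c =>
    rw [MvPolynomial.aeval_monomial, MvPolynomial.coeff_monomial,
      Finsupp.prod_fintype _ _ (by simp)]
    simp only [Fin.prod_univ_two, Matrix.cons_val_zero, Matrix.cons_val_one,
      Polynomial.algebraMap_apply, Algebra.algebraMap_self, RingHom.id_apply,
      Polynomial.coeff_C_mul]
    have key : m = Finsupp.single (0 : Fin 2) 0 + Finsupp.single (1 : Fin 2) j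
        ↔ m 0 = 0 ∧ m 1 = j := by
      rw [Finsupp.ext_iff, Fin.forall_fin_two]
      simp
    rw [if_congr key rfl rfl]
    by_cases h0 : m 0 = 0
    · simp [h0, Polynomial.coeff_X_pow, eq_comm]
    · simp [h0]
  | add f g hf hg => simp [hf, hg]

lemma St_eq (p j : ℕ) (f : MvPolynomial (Fin 2) (ZMod p)) :
    St p 0 j f = (psi p f).coeff j := by
  have this : ((MvPolynomial.aeval (![0, Polynomial.X] :
      Fin 2 → Polynomial (MvPolynomial (Fin 2) (ZMod p)))).restrictScalars (ZMod p)).comp (phi p)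
      = psi p := by
    apply MvPolynomial.algHom_ext
    intro i
    simp [phi, psi]
  rw [St, ← coeff_restrict, ← this, AlgHom.comp_apply, AlgHom.restrictScalars_apply]

lemma L2_ne (p : ℕ) (hp : p.Prime) : L2 p ≠ 0 := by
  have := Fact.mk hp
  intro h
  have := congrArg (MvPolynomial.aeval (![Polynomial.X, 1] : Fin 2 → Polynomial (ZMod p))) h
  have := congrArg (fun f => Polynomial.coeff f 1) this
  simp [L2, Polynomial.coeff_X_pow, hp.one_lt.ne] at this

lemma alg_id {S : Type*} [CommRing S] (p : ℕ) [CharP S p] [Fact p.Prime]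
    (y1 y2 Q0 Q1 t : S)
    (h1 : y1 ^ (p ^ 2) = Q1 * y1 ^ p - Q0 * y1) (h2 : y2 ^ (p ^ 2) = Q1 * y2 ^ p - Q0 * y2) :
    (y1 + y1 ^ (p ^ 2) * t) * (y2 + y2 ^ (p ^ 2) * t) ^ p
      - (y1 + y1 ^ (p ^ 2) * t) ^ p * (y2 + y2 ^ (p ^ 2) * t)
    = (1 - Q0 * t + (Q1 ^ (p + 1) - Q0 ^ p) * t ^ p + Q0 ^ (p + 1) * t ^ (p + 1))
      * (y1 * y2 ^ p - y1 ^ p * y2) := by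
  have cube : ∀ y : S, y ^ (p ^ 2) = Q1 * y ^ p - Q0 * y →
      (y ^ (p ^ 2)) ^ p = Q1 ^ p * (Q1 * y ^ p - Q0 * y) - Q0 ^ p * y ^ p := by
    intro y h
    nth_rw 1 [h]
    rw [sub_pow_char, mul_pow, mul_pow, ← pow_mul y, ← pow_two, h]
  rw [add_pow_char, add_pow_char, mul_pow, mul_pow, cube y1 h1, cube y2 h2, h1, h2]
  ring

lemma four {S : Type*} [CommRing S] (p : ℕ) [CharP S p] [Fact p.Prime]
    (y Q0 Q1 : S) (h : y ^ (p ^ 2) = Q1 * y ^ p - Q0 * y) :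
    (y ^ (p ^ 2)) ^ (p ^ 2) = (Q1 ^ (p ^ 2) * (Q1 ^ (p + 1) - Q0 ^ p) - Q0 ^ (p ^ 2) * Q1) * y ^ p
      + (- Q1 ^ (p ^ 2) * Q1 ^ p * Q0 + Q0 ^ (p ^ 2) * Q0) * y := by
  have cube : (y ^ (p ^ 2)) ^ p = Q1 ^ p * (Q1 * y ^ p - Q0 * y) - Q0 ^ p * y ^ p := by
    nth_rw 1 [h]
    rw [sub_pow_char, mul_pow, mul_pow, ← pow_mul y, ← pow_two, h]
  have e : (y ^ p) ^ (p ^ 2) = (y ^ (p ^ 2)) ^ p := by rw [← pow_mul, ← pow_mul, mul_comm]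
  nth_rw 1 [h]
  rw [sub_pow_char_pow, mul_pow, mul_pow, e, cube, h]
  ring

lemma alg_id2 {S : Type*} [CommRing S] (p : ℕ) [CharP S p] [Fact p.Prime]
    (y1 y2 Q0 Q1 A B t : S)
    (h1 : y1 ^ (p ^ 2) = Q1 * y1 ^ p - Q0 * y1) (h2 : y2 ^ (p ^ 2) = Q1 * y2 ^ p - Q0 * y2)
    (h3 : (y1 ^ (p ^ 2)) ^ (p ^ 2) = A * y1 ^ p + B * y1)
    (h4 : (y2 ^ (p ^ 2)) ^ (p ^ 2) = A * y2 ^ p + B * y2) :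
    (y1 + y1 ^ (p ^ 2) * t) * (y2 + y2 ^ (p ^ 2) * t) ^ (p ^ 2)
      - (y1 + y1 ^ (p ^ 2) * t) ^ (p ^ 2) * (y2 + y2 ^ (p ^ 2) * t)
    = (Q1 + t ^ (p ^ 2) * (A - (Q1 * B + Q0 * A) * t)) * (y1 * y2 ^ p - y1 ^ p * y2) := by
  rw [add_pow_char_pow, add_pow_char_pow, mul_pow, mul_pow, h3, h4, h1, h2]
  ring

lemma psi_Q1 (p : ℕ) (hp : p.Prime) (Q0 Q1 : MvPolynomial (Fin 2) (ZMod p))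
    (hQ0 : Q0 * L2 p = L20 p) (hQ1 : Q1 * L2 p = L21 p) :
    ∃ A B : MvPolynomial (Fin 2) (ZMod p),
    (1 - Polynomial.C Q0 * Polynomial.X + Polynomial.C (Q1 ^ (p + 1) - Q0 ^ p) * Polynomial.X ^ p + Polynomial.C (Q0 ^ (p + 1)) * Polynomial.X ^ (p + 1))
      * psi p Q1 = Polynomial.C Q1 + Polynomial.X ^ (p ^ 2) * (Polynomial.C A + Polynomial.C B * Polynomial.X) := by
  have := Fact.mk hp
  have hL := L2_ne p hp
  have h : ∀ k : Fin 2, (MvPolynomial.X k : MvPolynomial (Fin 2) (ZMod p)) ^ (p ^ 2)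
      = Q1 * MvPolynomial.X k ^ p - Q0 * MvPolynomial.X k := by
    intro k
    apply mul_right_cancel₀ hL
    have : (Q1 * MvPolynomial.X k ^ p - Q0 * MvPolynomial.X k) * L2 p
        = L21 p * MvPolynomial.X k ^ p - L20 p * MvPolynomial.X k := by
      rw [← hQ0, ← hQ1]; ring
    rw [this]
    fin_cases k <;> simp [L2, L20, L21] <;> ring
  obtain ⟨A, B, h4⟩ : ∃ A B : MvPolynomial (Fin 2) (ZMod p), ∀ k : Fin 2,
      ((MvPolynomial.X k : MvPolynomial (Fin 2) (ZMod p)) ^ (p ^ 2)) ^ (p ^ 2)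
      = A * MvPolynomial.X k ^ p + B * MvPolynomial.X k :=
    ⟨_, _, fun k => four p _ Q0 Q1 (h k)⟩
  refine ⟨A, -(Q1 * B + Q0 * A), ?_⟩
  have hC : ∀ k : Fin 2, (Polynomial.C (MvPolynomial.X k : MvPolynomial (Fin 2) (ZMod p))) ^ (p ^ 2)
      = Polynomial.C Q1 * Polynomial.C (MvPolynomial.X k) ^ p - Polynomial.C Q0 * Polynomial.C (MvPolynomial.X k) := by
    intro k
    simp only [← Polynomial.C_pow, ← Polynomial.C_mul, ← Polynomial.C_sub, h k]
  have hC4 : ∀ k : Fin 2,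
      ((Polynomial.C (MvPolynomial.X k : MvPolynomial (Fin 2) (ZMod p))) ^ (p ^ 2)) ^ (p ^ 2)
      = Polynomial.C A * Polynomial.C (MvPolynomial.X k) ^ p + Polynomial.C B * Polynomial.C (MvPolynomial.X k) := by
    intro k
    simp only [← Polynomial.C_pow, ← Polynomial.C_mul, ← Polynomial.C_add, h4 k]
  have i1 := alg_id p _ _ (Polynomial.C Q0) (Polynomial.C Q1) Polynomial.X (hC 0) (hC 1)
  have i2 := alg_id2 p _ _ (Polynomial.C Q0) (Polynomial.C Q1) (Polynomial.C A) (Polynomial.C B) Polynomial.X (hC 0) (hC 1) (hC4 0) (hC4 1)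
  have hCL : Polynomial.C (L2 p) = Polynomial.C (MvPolynomial.X 0) * Polynomial.C (MvPolynomial.X 1) ^ p
      - Polynomial.C (MvPolynomial.X 0) ^ p * Polynomial.C (MvPolynomial.X 1) := by
    simp [L2]
  have hCL0 : Polynomial.C (L2 p) ≠ 0 := by simpa using hL
  rw [← hCL] at i1 i2
  have j1 : psi p (L2 p) = _ := Eq.trans (by simp [psi, L2]) i1
  have j2 : psi p (L21 p) = _ := Eq.trans (by simp [psi, L21]) i2
  have j3 := congrArg (psi p) hQ1
  rw [map_mul, j1, j2] at j3
  apply mul_right_cancel₀ hCL0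
  simp only [Polynomial.C_pow, Polynomial.C_sub, Polynomial.C_neg, Polynomial.C_add, Polynomial.C_mul]
  linear_combination j3

end

theorem st_0j_Q21 (p : ℕ) (hp : p.Prime) (hodd : Odd p)
    (Q0 Q1 : MvPolynomial (Fin 2) (ZMod p))
    (hQ0 : Q0 * L2 p = L20 p) (hQ1 : Q1 * L2 p = L21 p)
    (j : ℕ) :
    (∀ k r : ℕ, k < p → r < p → j = k * p + r →
      St p 0 j Q1 = Q0 ^ r * Q1 *
        ∑ i ∈ Finset.range (k + 1),
          (-1 : MvPolynomial (Fin 2) (ZMod p)) ^ i *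
            C (((k + 1).choose (i + 1) : ZMod p)) * C (((r + i).choose i : ZMod p)) *
            Q0 ^ ((k - i) * p) * Q1 ^ (i * (p + 1))) ∧
    (p ^ 2 ≤ j → St p 0 j Q1 = 0) := by
  have := Fact.mk hp
  have hp2 := hp.two_le
  obtain ⟨A, B, h⟩ := psi_Q1 p hp Q0 Q1 hQ0 hQ1
  simp only [St_eq]
  have hL := L2_ne p hp
  have hL20 : L20 p = L2 p ^ p := by
    rw [L2, L20, sub_pow_char, mul_pow, mul_pow, ← pow_mul, ← pow_mul, ← pow_two]
  have hQ0ne : Q0 ≠ 0 := by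
    rintro rfl
    rw [zero_mul, hL20] at hQ0
    exact pow_ne_zero p hL hQ0.symm
  generalize psi p Q1 = G at h ⊢
  constructor
  · intro k r hk hr hj
    have hmain := congrArg (fun f => Polynomial.X ^ p * f) h
    have hexp : (Polynomial.X ^ p * G) - Polynomial.C Q0 * (Polynomial.X ^ p * G * Polynomial.X)
        + Polynomial.C (Q1 ^ (p + 1) - Q0 ^ p) * (Polynomial.X ^ p * G * Polynomial.X ^ p)
        + Polynomial.C (Q0 ^ (p + 1)) * (Polynomial.X ^ p * G * Polynomial.X ^ (p + 1))
        = Polynomial.C Q1 * Polynomial.X ^ p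
          + (Polynomial.C A + Polynomial.C B * Polynomial.X) * Polynomial.X ^ (p ^ 2 + p) := by
      have hmain : Polynomial.X ^ p * _ = Polynomial.X ^ p * _ := hmain
      linear_combination hmain
    have hs := rec_solve p hp Q0 (Q1 ^ (p + 1)) Q1 (fun n => (Polynomial.X ^ p * G).coeff n)
      (fun n hn => by simp [Polynomial.coeff_X_pow_mul', hn]) (by
        have h0 := congrArg (fun f => Polynomial.coeff f 0) h
        have hp0 : ¬ (0 = p) := by omega
        have hp1 : ¬ (0 = p ^ 2) := fun h => pow_ne_zero 2 hp.ne_zero h.symm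
        simpa [Polynomial.coeff_X_pow_mul', Polynomial.mul_coeff_zero, hp0, hp1] using h0)
      (fun n hn => by
        have hc := congrArg (fun f => Polynomial.coeff f (n + p + 1)) hexp
        have n1 : ¬ (p ^ 2 + p ≤ n + p + 1) := by omega
        have n2 : n + p + 1 ≠ p := by omega
        have n3 : p ≤ n + p + 1 := by omega
        have n4 : n + p + 1 - p = n + 1 := by omega
        have n5 : p + 1 ≤ n + p + 1 := by omega
        have n6 : n + p + 1 - (p + 1) = n := by omega
        simp only [Polynomial.coeff_add, Polynomial.coeff_sub, Polynomial.coeff_C_mul,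
          Polynomial.coeff_mul_X] at hc
        simp only [Polynomial.coeff_mul_X_pow' (Polynomial.X ^ p * G),
          Polynomial.coeff_mul_X_pow' (Polynomial.C A + Polynomial.C B * Polynomial.X),
          Polynomial.coeff_X_pow, n1, n2, n3, n4, n5, n6, if_true, if_false, mul_zero,
          add_zero] at hc
        exact hc)
      (k + 1) (by omega) r hr
    have e : (k + 1) * p + r = j + p := by rw [hj]; ring
    simp only [e, Polynomial.coeff_X_pow_mul] at hs
    rw [hs, TT, mul_left_comm, ← mul_assoc]
    refine congrArg (fun z => Q0 ^ r * Q1 * z) (Finset.sum_congr rfl fun i hi => ?_)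
    rw [map_natCast, map_natCast, ← pow_mul, ← pow_mul, mul_comm p, mul_comm (p + 1),
      Nat.add_sub_cancel]
  · intro hj
    by_contra hne
    have hG : G ≠ 0 := by rintro rfl; simp at hne
    have hGd := Polynomial.le_natDegree_of_ne_zero hne
    set D := (1 - Polynomial.C Q0 * Polynomial.X
      + Polynomial.C (Q1 ^ (p + 1) - Q0 ^ p) * Polynomial.X ^ p
      + Polynomial.C (Q0 ^ (p + 1)) * Polynomial.X ^ (p + 1)) with hD
    have hDc : D.coeff (p + 1) ≠ 0 := by
      have hp0 : p ≠ 0 := hp.ne_zero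
      have : D.coeff (p + 1) = Q0 ^ (p + 1) := by
        simp only [hD, Polynomial.coeff_add, Polynomial.coeff_sub, Polynomial.coeff_C_mul,
          Polynomial.coeff_X_pow, Polynomial.coeff_X, Polynomial.coeff_one]
        simp [hp0]
      rw [this]
      exact pow_ne_zero _ hQ0ne
    have hD0 : D ≠ 0 := by intro h0; rw [h0] at hDc; simp at hDc
    have hDd := Polynomial.le_natDegree_of_ne_zero hDc
    have hm := Polynomial.natDegree_mul hD0 hG
    rw [h] at hm
    have hle : (Polynomial.C Q1 + Polynomial.X ^ (p ^ 2)
        * (Polynomial.C A + Polynomial.C B * Polynomial.X)).natDegree ≤ p ^ 2 + 1 := by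
      compute_degree
    omega
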